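/- Let N ≥ 2 and α ∈ (0, α_N), and let B ⊂ ℝ^N be the open unit ball. There exists a continuous ρ : B → (0,∞) such that, for every γ > 0, sup { ∫_B Φ^γ(u(x)) ρ(x)^{N/2} dx : u ∈ C_c^∞(B), ∫_B |∇u(x)|^N dx ≤ 1 } < +∞ if and only if 0 < γ < α. -/

import Mathlib

open MeasureTheory Real

/-- `ω_{N-1}`, the `(N-1)`-dimensional measure of the unit sphere in `ℝ^N`. -/
noncomputable def sphereVol (N : ℕ) : ℝ :=
  N * Real.pi ^ ((N : ℝ) / 2) / Real.Gamma ((N : ℝ) / 2 + 1)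

/-- `α_N := N ω_{N-1}^{1/(N-1)}`. -/
noncomputable def alphaMT (N : ℕ) : ℝ := N * sphereVol N ^ ((1 : ℝ) / ((N : ℝ) - 1))

/-- `Φ^γ(t) := e^{γ |t|^{N/(N-1)}} - ∑_{j=0}^{N-2} γ^j |t|^{jN/(N-1)} / j!`. -/
noncomputable def PhiGamma (N : ℕ) (γ : ℝ) (t : ℝ) : ℝ :=
  Real.exp (γ * |t| ^ ((N : ℝ) / ((N : ℝ) - 1))) -
    ∑ j ∈ Finset.range (N - 1),
      γ ^ j * |t| ^ ((j : ℝ) * N / ((N : ℝ) - 1)) / (Nat.factorial j : ℝ)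

/-- The open unit ball of `ℝ^N`. -/
noncomputable def unitBall (N : ℕ) : Set (EuclideanSpace ℝ (Fin N)) := Metric.ball 0 1

/-- `u ∈ C_c^∞(Ω)`: smooth, compactly supported, with support contained in `Ω`. -/
def IsTest {N : ℕ} (Ω : Set (EuclideanSpace ℝ (Fin N)))
    (u : EuclideanSpace ℝ (Fin N) → ℝ) : Prop :=
  ContDiff ℝ (⊤ : ℕ∞) u ∧ HasCompactSupport u ∧ tsupport u ⊆ Ω

section
open MeasureTheory Real Set
open scoped ENNReal

lemma sphereVol_pos {N : ℕ} (hN : 2 ≤ N) : 0 < sphereVol N := by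
  unfold sphereVol
  have : (0:ℝ) < N := by positivity
  have h2 : 0 < Real.Gamma ((N : ℝ) / 2 + 1) := Real.Gamma_pos_of_pos (by positivity)
  positivity

lemma toSphere_univ {N : ℕ} (hN : 2 ≤ N) :
    (volume : Measure (EuclideanSpace ℝ (Fin N))).toSphere univ = ENNReal.ofReal (sphereVol N) := by
  have : Nonempty (Fin N) := ⟨⟨0, by omega⟩⟩
  rw [Measure.toSphere_apply_univ, EuclideanSpace.volume_ball, finrank_euclideanSpace]
  simp only [Fintype.card_fin, ENNReal.ofReal_one, one_pow, one_mul]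
  rw [← ENNReal.ofReal_natCast, ← ENNReal.ofReal_mul (by positivity), sphereVol]
  congr 1
  rw [Real.sqrt_eq_rpow, ← Real.rpow_natCast, ← Real.rpow_mul Real.pi_pos.le]
  rw [mul_div_assoc]
  congr 3
  ring

lemma polar {N : ℕ} (hN : 2 ≤ N) (F : EuclideanSpace ℝ (Fin N) → ℝ≥0∞) (hF : Measurable F) :
    ∫⁻ x, F x = ∫⁻ θ : Metric.sphere (0 : EuclideanSpace ℝ (Fin N)) 1, (∫⁻ r in Ioi (0:ℝ),
      ENNReal.ofReal (r ^ (N - 1)) * F (r • (θ : EuclideanSpace ℝ (Fin N))))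
      ∂(volume : Measure (EuclideanSpace ℝ (Fin N))).toSphere := by
  have : Nonempty (Fin N) := ⟨⟨0, by omega⟩⟩
  set μ := (volume : Measure (EuclideanSpace ℝ (Fin N))) with hμ
  have h := (μ.measurePreserving_homeomorphUnitSphereProd).lintegral_comp_emb
    (Homeomorph.measurableEmbedding _)
    (fun p => F ((p.2 : ℝ) • (p.1 : EuclideanSpace ℝ (Fin N))))
  rw [finrank_euclideanSpace, Fintype.card_fin] at h
  have h1 : ∫⁻ x, F x = ∫⁻ x : ({(0)}ᶜ : Set (EuclideanSpace ℝ (Fin N))), F x.1 ∂(μ.comap (↑)) := by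
    rw [lintegral_subtype_comap (measurableSet_singleton _).compl F, restrict_compl_singleton]
  rw [h1]
  have h2 : ∀ x : ({(0)}ᶜ : Set (EuclideanSpace ℝ (Fin N))),
      (((homeomorphUnitSphereProd (EuclideanSpace ℝ (Fin N)) x).2 : ℝ) •
        ((homeomorphUnitSphereProd (EuclideanSpace ℝ (Fin N)) x).1 : EuclideanSpace ℝ (Fin N))) = x.1 := by
    intro x
    have : (x.1 : EuclideanSpace ℝ (Fin N)) ≠ 0 := x.2
    simp [this]
  simp_rw [h2] at h
  rw [h, lintegral_prod]
  · congr 1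
    ext θ
    rw [Measure.volumeIoiPow, lintegral_withDensity_eq_lintegral_mul]
    · simp only [Pi.mul_apply]
      rw [lintegral_subtype_comap measurableSet_Ioi (fun r : ℝ => ENNReal.ofReal (r ^ (N - 1)) * F (r • (θ : EuclideanSpace ℝ (Fin N))))]
    · fun_prop
    · fun_prop
  · apply Measurable.aemeasurable
    fun_prop

lemma radial {N : ℕ} (hN : 2 ≤ N) (g : ℝ → ℝ≥0∞) (hg : Measurable g) :
    ∫⁻ x : EuclideanSpace ℝ (Fin N), g ‖x‖ = ENNReal.ofReal (sphereVol N) *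
      ∫⁻ r in Ioi (0:ℝ), ENNReal.ofReal (r ^ (N - 1)) * g r := by
  rw [polar hN (fun x => g ‖x‖) (by fun_prop), ← toSphere_univ hN]
  rw [mul_comm, ← lintegral_const]
  congr 1
  ext θ
  apply setLIntegral_congr_fun measurableSet_Ioi
  intro r hr
  have : ‖(θ : EuclideanSpace ℝ (Fin N))‖ = 1 := by simpa using θ.2
  simp only [norm_smul, this, mul_one, Real.norm_eq_abs, abs_of_pos (show 0 < r from hr)]

noncomputable def rieszK (N : ℕ) (r : ℝ) : ℝ≥0∞ := (ENNReal.ofReal (r ^ (N - 1)))⁻¹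

lemma measurable_rieszK (N : ℕ) : Measurable (rieszK N) := by unfold rieszK; fun_prop

lemma near_ker {N : ℕ} (hN : 2 ≤ N) {δ : ℝ} :
    ∫⁻ x : EuclideanSpace ℝ (Fin N), (Iic δ).indicator (rieszK N) ‖x‖ =
      ENNReal.ofReal (sphereVol N * δ) := by
  rw [radial hN _ ((measurable_rieszK N).indicator measurableSet_Iic), ENNReal.ofReal_mul (sphereVol_pos hN).le]
  congr 1
  have : ∫⁻ r in Ioi (0:ℝ), ENNReal.ofReal (r ^ (N - 1)) * (Iic δ).indicator (rieszK N) r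
      = ∫⁻ r in Ioi (0:ℝ), (Iic δ).indicator 1 r := by
    apply setLIntegral_congr_fun measurableSet_Ioi
    intro r hr
    have hr : 0 < r := hr
    by_cases h : r ≤ δ
    · simp only [mem_Iic, h, indicator_of_mem, rieszK, Pi.one_apply]
      exact ENNReal.mul_inv_cancel (by simp; positivity) (by simp)
    · simp [h]
  rw [this, lintegral_indicator_one measurableSet_Iic, Measure.restrict_apply measurableSet_Iic,
    inter_comm, Ioi_inter_Iic, Real.volume_Ioc, sub_zero]

lemma lintegral_inv_Ioo {a b : ℝ} (ha : 0 < a) (hab : a ≤ b) :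
    ∫⁻ r in Ioc a b, ENNReal.ofReal r⁻¹ = ENNReal.ofReal (Real.log (b / a)) := by
  have hi : IntervalIntegrable (fun r : ℝ => r⁻¹) volume a b := by
    rw [intervalIntegrable_inv_iff]
    right
    rw [uIcc_of_le hab]
    intro h
    linarith [h.1]
  rw [← ofReal_integral_eq_lintegral_ofReal hi.1, ← intervalIntegral.integral_of_le hab, integral_inv_of_pos ha (by linarith)]
  filter_upwards [ae_restrict_mem measurableSet_Ioc] with y hy
  have := hy.1
  simp; linarith

lemma far_ker {N : ℕ} (hN : 2 ≤ N) {δ b : ℝ} (hδ : 0 < δ) (hb : δ ≤ b) :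
    ∫⁻ x : EuclideanSpace ℝ (Fin N), ((Ioc δ b).indicator (rieszK N) ‖x‖) ^ ((N:ℝ) / ((N:ℝ) - 1)) =
      ENNReal.ofReal (sphereVol N * Real.log (b / δ)) := by
  have hN1 : (2:ℝ) ≤ N := by exact_mod_cast hN
  rw [radial hN (fun r => ((Ioc δ b).indicator (rieszK N) r) ^ ((N:ℝ) / ((N:ℝ) - 1)))
    (((measurable_rieszK N).indicator measurableSet_Ioc).pow_const _), ENNReal.ofReal_mul (sphereVol_pos hN).le]
  congr 1
  have : ∫⁻ r in Ioi (0:ℝ), ENNReal.ofReal (r ^ (N - 1)) * ((Ioc δ b).indicator (rieszK N) r) ^ ((N:ℝ) / ((N:ℝ) - 1))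
      = ∫⁻ r in Ioi (0:ℝ), (Ioc δ b).indicator (fun r => ENNReal.ofReal r⁻¹) r := by
    apply setLIntegral_congr_fun measurableSet_Ioi
    intro r hr
    have hr : 0 < r := hr
    by_cases h : r ∈ Ioc δ b
    · simp only [h, indicator_of_mem, rieszK]
      rw [← ENNReal.ofReal_inv_of_pos (by positivity), ENNReal.ofReal_rpow_of_pos (by positivity),
        ← ENNReal.ofReal_mul (by positivity)]
      congr 1
      rw [← Real.rpow_natCast, ← Real.rpow_neg hr.le, ← Real.rpow_mul hr.le, ← Real.rpow_add hr, ← Real.rpow_neg_one]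
      congr 1
      rw [Nat.cast_sub (by omega)]
      have : (N:ℝ) - 1 ≠ 0 := by linarith
      push_cast
      field_simp
      ring
    · simp only [h, not_false_eq_true, indicator_of_notMem]
      rw [ENNReal.zero_rpow_of_pos, mul_zero]
      apply div_pos <;> linarith
  rw [this, lintegral_indicator measurableSet_Ioc, Measure.restrict_restrict measurableSet_Ioc,
    inter_eq_left.2, lintegral_inv_Ioo hδ hb]
  intro x hx
  exact hδ.trans hx.1
end

section
open MeasureTheory Real Set
open scoped ENNReal

lemma repr_bound {N : ℕ} (hN : 2 ≤ N) {u : EuclideanSpace ℝ (Fin N) → ℝ}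
    (hu : ContDiff ℝ 1 u) (hc : HasCompactSupport u) (x : EuclideanSpace ℝ (Fin N)) :
    ENNReal.ofReal (sphereVol N) * ‖u x‖ₑ ≤ ∫⁻ z, ‖fderiv ℝ u (x + z)‖ₑ * rieszK N ‖z‖ := by
  have hcont : Continuous (fderiv ℝ u) := hu.continuous_fderiv (by norm_num)
  rw [polar hN (fun z => ‖fderiv ℝ u (x + z)‖ₑ * rieszK N ‖z‖)
    (by have := measurable_rieszK N; fun_prop), ← toSphere_univ hN]
  rw [mul_comm, ← lintegral_const]
  apply lintegral_mono
  intro θ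
  have hθ : ‖(θ : EuclideanSpace ℝ (Fin N))‖ = 1 := by simp
  have e : ∫⁻ r in Ioi (0:ℝ), ENNReal.ofReal (r ^ (N - 1)) *
      (‖fderiv ℝ u (x + r • (θ : EuclideanSpace ℝ (Fin N)))‖ₑ * rieszK N ‖r • (θ : EuclideanSpace ℝ (Fin N))‖)
      = ∫⁻ r in Ioi (0:ℝ), ‖fderiv ℝ u (x + r • (θ : EuclideanSpace ℝ (Fin N)))‖ₑ := by
    apply setLIntegral_congr_fun measurableSet_Ioi
    intro r hr
    have hr : 0 < r := hr
    simp only [norm_smul, hθ, mul_one, Real.norm_eq_abs, abs_of_pos hr, rieszK]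
    rw [mul_left_comm, ENNReal.mul_inv_cancel (by simp; positivity) (by simp), mul_one]
  dsimp only
  rw [e]
  set φ : ℝ → ℝ := fun r => u (x + r • (θ : EuclideanSpace ℝ (Fin N))) with hφ
  have hφd : ∀ r, HasDerivAt φ (fderiv ℝ u (x + r • (θ : EuclideanSpace ℝ (Fin N))) θ) r := by
    intro r
    have h1 := (hu.differentiable (by norm_num) (x + r • (θ : EuclideanSpace ℝ (Fin N)))).hasFDerivAt
    have h2 : HasDerivAt (fun r : ℝ => x + r • (θ : EuclideanSpace ℝ (Fin N))) (θ : EuclideanSpace ℝ (Fin N)) r := by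
      simpa using ((hasDerivAt_id r).smul_const (θ : EuclideanSpace ℝ (Fin N))).const_add x
    exact h1.comp_hasDerivAt r h2
  have hφc : ContDiff ℝ 1 φ := by
    apply hu.comp
    fun_prop
  have hφs : HasCompactSupport φ := by
    obtain ⟨R, hR⟩ := hc.isCompact.isBounded.subset_closedBall 0
    apply HasCompactSupport.intro (isCompact_closedBall (0:ℝ) (R + ‖x‖))
    intro r hr
    change u (x + r • (θ : EuclideanSpace ℝ (Fin N))) = 0
    apply image_eq_zero_of_notMem_tsupport
    intro hmem
    have h1 := hR hmem
    simp only [mem_closedBall_zero_iff] at h1 hr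
    apply hr
    have : ‖r • (θ : EuclideanSpace ℝ (Fin N))‖ = ‖r‖ := by rw [norm_smul, hθ, mul_one]
    rw [← this]
    have := norm_sub_le (x + r • (θ : EuclideanSpace ℝ (Fin N))) x
    rw [add_sub_cancel_left] at this
    linarith
  have h3 := hφs.integral_Ioi_deriv_eq hφc 0
  have h4 : ‖u x‖ₑ = ‖∫ r in Ioi (0:ℝ), deriv φ r‖ₑ := by
    rw [h3]; simp [hφ]
  rw [h4]
  refine (enorm_integral_le_lintegral_enorm _).trans (lintegral_mono fun r => ?_)
  rw [(hφd r).deriv]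
  have := (fderiv ℝ u (x + r • (θ : EuclideanSpace ℝ (Fin N)))).le_opENorm θ
  have h5 : ‖(θ : EuclideanSpace ℝ (Fin N))‖ₑ = 1 := by
    rw [← ofReal_norm, hθ]; simp
  rwa [h5, mul_one] at this

noncomputable def nearPart {N : ℕ} (f : EuclideanSpace ℝ (Fin N) → ℝ≥0∞) (δ : ℝ)
    (x : EuclideanSpace ℝ (Fin N)) : ℝ≥0∞ := ∫⁻ z, f (x + z) * (Iic δ).indicator (rieszK N) ‖z‖

lemma holderN {N : ℕ} (hN : 2 ≤ N) : (N:ℝ).HolderConjugate ((N:ℝ) / ((N:ℝ) - 1)) := by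
  have hN1 : (2:ℝ) ≤ N := by exact_mod_cast hN
  rw [Real.holderConjugate_iff_eq_conjExponent (by linarith)]

lemma measurable_nearPart {N : ℕ} {f : EuclideanSpace ℝ (Fin N) → ℝ≥0∞}
    (hf : Measurable f) (δ : ℝ) : Measurable (nearPart f δ) := by
  unfold nearPart
  have hk : Measurable ((Iic δ).indicator (rieszK N)) := (measurable_rieszK N).indicator measurableSet_Iic
  apply Measurable.lintegral_prod_right'
    (f := fun p : EuclideanSpace ℝ (Fin N) × EuclideanSpace ℝ (Fin N) => f (p.1 + p.2) * (Iic δ).indicator (rieszK N) ‖p.2‖)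
  fun_prop

lemma nearPart_le {N : ℕ} (hN : 2 ≤ N) {f : EuclideanSpace ℝ (Fin N) → ℝ≥0∞}
    (hf : Measurable f) (h1 : ∫⁻ y, f y ^ (N:ℝ) ≤ 1) (δ : ℝ) :
    ∫⁻ x, nearPart f δ x ^ (N:ℝ) ≤ ENNReal.ofReal (sphereVol N * δ) ^ (N:ℝ) := by
  have hN1 : (2:ℝ) ≤ N := by exact_mod_cast hN
  have hk : Measurable ((Iic δ).indicator (rieszK N)) := (measurable_rieszK N).indicator measurableSet_Iic
  set k := (Iic δ).indicator (rieszK N) with hkdef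
  set q := (N:ℝ) / ((N:ℝ) - 1) with hq
  have hpq := holderN hN
  rw [← hq] at hpq
  have hD : ∫⁻ z : EuclideanSpace ℝ (Fin N), k ‖z‖ = ENNReal.ofReal (sphereVol N * δ) := near_ker hN
  set D := ENNReal.ofReal (sphereVol N * δ) with hDdef
  have key : ∀ x, nearPart f δ x ^ (N:ℝ) ≤ (∫⁻ z, f (x + z) ^ (N:ℝ) * k ‖z‖) * D ^ ((N:ℝ) - 1) := by
    intro x
    have h := ENNReal.lintegral_mul_le_Lp_mul_Lq (volume : Measure (EuclideanSpace ℝ (Fin N))) hpq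
      (f := fun z => f (x + z) * k ‖z‖ ^ (1 / (N:ℝ))) (g := fun z => k ‖z‖ ^ (1 / q))
      (by fun_prop) (by fun_prop)
    have e1 : ∫⁻ z, ((fun z : EuclideanSpace ℝ (Fin N) => f (x + z) * k ‖z‖ ^ (1 / (N:ℝ))) * (fun z : EuclideanSpace ℝ (Fin N) => k ‖z‖ ^ (1 / q)) : EuclideanSpace ℝ (Fin N) → ℝ≥0∞) z
        = nearPart f δ x := by
      unfold nearPart
      congr 1
      ext z
      simp only [Pi.mul_apply]
      rw [mul_assoc, ← ENNReal.rpow_add_of_nonneg _ _ (by positivity) (one_div_nonneg.2 hpq.symm.nonneg)]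
      have : 1 / (N:ℝ) + 1 / q = 1 := by
        have := hpq.inv_add_inv_eq_one
        simpa using this
      rw [this, ENNReal.rpow_one]
    have e2 : ∀ z, (f (x + z) * k ‖z‖ ^ (1 / (N:ℝ))) ^ (N:ℝ) = f (x + z) ^ (N:ℝ) * k ‖z‖ := by
      intro z
      rw [ENNReal.mul_rpow_of_nonneg _ _ (by positivity), ← ENNReal.rpow_mul, one_div_mul_cancel (by positivity),
        ENNReal.rpow_one]
    have e3 : ∀ z : EuclideanSpace ℝ (Fin N), (k ‖z‖ ^ (1 / q)) ^ q = k ‖z‖ := by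
      intro z
      rw [← ENNReal.rpow_mul, one_div_mul_cancel hpq.symm.ne_zero, ENNReal.rpow_one]
    rw [e1] at h
    simp_rw [e2, e3, hD] at h
    calc nearPart f δ x ^ (N:ℝ) ≤ ((∫⁻ z, f (x + z) ^ (N:ℝ) * k ‖z‖) ^ (1 / (N:ℝ)) * D ^ (1 / q)) ^ (N:ℝ) := by
          gcongr
      _ = _ := by
          rw [ENNReal.mul_rpow_of_nonneg _ _ (by positivity), ← ENNReal.rpow_mul, one_div_mul_cancel (by positivity),
            ENNReal.rpow_one, ← ENNReal.rpow_mul]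
          congr 2
          rw [hq]
          have : (N:ℝ) - 1 ≠ 0 := by linarith
          field_simp
  calc ∫⁻ x, nearPart f δ x ^ (N:ℝ) ≤ ∫⁻ x, (∫⁻ z, f (x + z) ^ (N:ℝ) * k ‖z‖) * D ^ ((N:ℝ) - 1) :=
        lintegral_mono key
    _ = (∫⁻ x, ∫⁻ z, f (x + z) ^ (N:ℝ) * k ‖z‖) * D ^ ((N:ℝ) - 1) := by
        rw [lintegral_mul_const']
        exact ENNReal.rpow_ne_top_of_nonneg (by linarith) (by simp [hDdef])
    _ = (∫⁻ z, ∫⁻ x, f (x + z) ^ (N:ℝ) * k ‖z‖) * D ^ ((N:ℝ) - 1) := by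
        rw [lintegral_lintegral_swap]
        apply Measurable.aemeasurable
        unfold Function.uncurry
        fun_prop
    _ ≤ (∫⁻ z : EuclideanSpace ℝ (Fin N), k ‖z‖) * D ^ ((N:ℝ) - 1) := by
        gcongr with z
        rw [lintegral_mul_const _ (by fun_prop), lintegral_add_right_eq_self (fun x => f x ^ (N:ℝ))]
        calc _ ≤ 1 * k ‖z‖ := by gcongr
          _ = _ := one_mul _
    _ = D ^ (N:ℝ) := by
        rw [hD]
        nth_rw 1 [← ENNReal.rpow_one D]
        rw [← ENNReal.rpow_add_of_nonneg _ _ (by norm_num) (by linarith)]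
        congr 1
        ring

lemma split_bound {N : ℕ} (hN : 2 ≤ N) {u : EuclideanSpace ℝ (Fin N) → ℝ}
    (hu : IsTest (unitBall N) u)
    (h1 : ∫⁻ y, ‖fderiv ℝ u y‖ₑ ^ (N:ℝ) ≤ 1) {x : EuclideanSpace ℝ (Fin N)} (hx : x ∈ unitBall N)
    {δ : ℝ} (hδ : 0 < δ) (hδ2 : δ ≤ 2) :
    ENNReal.ofReal (sphereVol N) * ‖u x‖ₑ ≤
      nearPart (fun y => ‖fderiv ℝ u y‖ₑ) δ x +
      ENNReal.ofReal (sphereVol N * Real.log (2 / δ)) ^ (1 / ((N:ℝ) / ((N:ℝ) - 1))) := by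
  have hu1 : ContDiff ℝ 1 u := hu.1.of_le (by exact_mod_cast le_top)
  have hcont : Continuous (fderiv ℝ u) := hu1.continuous_fderiv (by norm_num)
  have hk : Measurable ((Iic δ).indicator (rieszK N)) := (measurable_rieszK N).indicator measurableSet_Iic
  have hk2 : Measurable ((Ioc δ 2).indicator (rieszK N)) := (measurable_rieszK N).indicator measurableSet_Ioc
  refine (repr_bound hN hu1 hu.2.1 x).trans ?_
  have hpt : ∀ z, ‖fderiv ℝ u (x + z)‖ₑ * rieszK N ‖z‖ ≤
      ‖fderiv ℝ u (x + z)‖ₑ * (Iic δ).indicator (rieszK N) ‖z‖ +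
      ‖fderiv ℝ u (x + z)‖ₑ * (Ioc δ 2).indicator (rieszK N) ‖z‖ := by
    intro z
    by_cases h : x + z ∈ tsupport (fderiv ℝ u)
    · have hz : ‖z‖ ≤ 2 := by
        have h2 := hu.2.2 (tsupport_fderiv_subset ℝ h)
        simp only [unitBall, mem_ball_zero_iff] at h2 hx
        have := norm_sub_le (x + z) x
        rw [add_sub_cancel_left] at this
        linarith
      by_cases hz2 : ‖z‖ ≤ δ
      · have : ‖z‖ ∈ Iic δ := hz2
        rw [indicator_of_mem this]
        exact le_self_add
      · have : ‖z‖ ∈ Ioc δ 2 := ⟨not_le.1 hz2, hz⟩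
        rw [indicator_of_mem this]
        exact le_add_self
    · have h0 : fderiv ℝ u (x + z) = 0 := image_eq_zero_of_notMem_tsupport h
      have h00 : ‖fderiv ℝ u (x + z)‖ₑ = 0 := by
        rw [← ofReal_norm, h0, norm_zero, ENNReal.ofReal_zero]
      rw [h00, zero_mul]
      exact zero_le
  refine (lintegral_mono hpt).trans ?_
  rw [lintegral_add_left (by fun_prop)]
  unfold nearPart
  gcongr
  refine (ENNReal.lintegral_mul_le_Lp_mul_Lq _ (holderN hN) (by fun_prop) (by fun_prop)).trans ?_
  rw [far_ker hN hδ hδ2, lintegral_add_left_eq_self (fun y => ‖fderiv ℝ u y‖ₑ ^ (N:ℝ))]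
  calc _ ≤ 1 ^ (1 / (N:ℝ)) * ENNReal.ofReal (sphereVol N * Real.log (2 / δ)) ^ (1 / ((N:ℝ) / ((N:ℝ) - 1))) := by
        gcongr
    _ = _ := by simp
end

section
open MeasureTheory Real Set Filter Topology
open scoped ENNReal

noncomputable def lev (N : ℕ) (j : ℕ) : ℝ :=
  (sphereVol N)⁻¹ * (sphereVol N * j) ^ (1 / ((N:ℝ) / ((N:ℝ) - 1))) + 1

lemma q_gt_one {N : ℕ} (hN : 2 ≤ N) : 1 < (N:ℝ) / ((N:ℝ) - 1) := by
  have hN1 : (2:ℝ) ≤ N := by exact_mod_cast hN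
  rw [lt_div_iff₀ (by linarith)]; linarith

lemma const_id {N : ℕ} (hN : 2 ≤ N) :
    ((sphereVol N)⁻¹ * sphereVol N ^ (1 / ((N:ℝ) / ((N:ℝ) - 1)))) ^ ((N:ℝ) / ((N:ℝ) - 1)) = N / alphaMT N := by
  have hN1 : (2:ℝ) ≤ N := by exact_mod_cast hN
  have hw := sphereVol_pos hN
  have h1 : (N:ℝ) - 1 ≠ 0 := by linarith
  have h0 : (N:ℝ) ≠ 0 := by linarith
  rw [alphaMT, div_mul_cancel_left₀ h0, ← Real.rpow_neg_one (sphereVol N), ← Real.rpow_add hw, ← Real.rpow_mul hw.le,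
    ← Real.rpow_neg_one, ← Real.rpow_mul hw.le]
  congr 1
  field_simp
  ring

lemma alphaMT_pos {N : ℕ} (hN : 2 ≤ N) : 0 < alphaMT N := by
  have hw := sphereVol_pos hN
  have hN1 : (2:ℝ) ≤ N := by exact_mod_cast hN
  unfold alphaMT
  positivity

lemma summable_lev {N : ℕ} (hN : 2 ≤ N) {γ : ℝ} (hγ : 0 < γ) (hγ2 : γ < alphaMT N) :
    Summable (fun j : ℕ => Real.exp (γ * lev N (j + 1) ^ ((N:ℝ) / ((N:ℝ) - 1))) * (2 * Real.exp (-j)) ^ (N:ℝ)) := by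
  have hN1 : (2:ℝ) ≤ N := by exact_mod_cast hN
  have hw := sphereVol_pos hN
  have hα := alphaMT_pos hN
  have hq1 := q_gt_one hN
  have hid := const_id hN
  set q := (N:ℝ) / ((N:ℝ) - 1) with hq
  set ω := sphereVol N with hω
  have hq0 : 0 < q := by linarith
  set b : ℕ → ℝ := fun j => γ * (ω⁻¹ * (ω * (1 + (j:ℝ)⁻¹)) ^ (1 / q) + (j:ℝ) ^ (-(1 / q))) ^ q with hb
  have hlim : Tendsto b atTop (𝓝 (γ * (ω⁻¹ * (ω * (1 + 0)) ^ (1 / q) + 0) ^ q)) := by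
    refine Tendsto.const_mul _ (Tendsto.rpow_const (Tendsto.add (Tendsto.const_mul _ (Tendsto.rpow_const
      (Tendsto.const_mul _ (Tendsto.const_add _ tendsto_inv_atTop_nhds_zero_nat)) (Or.inr (by positivity))))
      ((tendsto_rpow_neg_atTop (by positivity)).comp tendsto_natCast_atTop_atTop)) (Or.inr (by positivity)))
  have hlt : γ * (ω⁻¹ * (ω * (1 + 0)) ^ (1 / q) + 0) ^ q < N := by
    rw [add_zero, add_zero, mul_one, hid, ← mul_div_assoc, div_lt_iff₀ hα]
    nlinarith
  obtain ⟨θ, hθ1, hθ2⟩ := exists_between hlt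
  have hev := hlim.eventually (gt_mem_nhds hθ1)
  have hgeo : Summable (fun j : ℕ => (2:ℝ) ^ (N:ℝ) * (Real.exp (-(N - θ))) ^ j) := by
    apply Summable.mul_left
    apply summable_geometric_of_lt_one (by positivity)
    rw [Real.exp_lt_one_iff]; linarith
  apply Summable.of_norm_bounded_eventually_nat hgeo
  filter_upwards [hev, eventually_gt_atTop 0] with j hj hj0
  have hj0' : (0:ℝ) < j := by exact_mod_cast hj0
  have hlev : γ * lev N (j + 1) ^ q = j * b j := by
    have : lev N (j+1) = (j:ℝ) ^ (1 / q) * (ω⁻¹ * (ω * (1 + (j:ℝ)⁻¹)) ^ (1 / q) + (j:ℝ) ^ (-(1 / q))) := by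
      rw [mul_add, ← Real.rpow_add hj0', add_neg_cancel, Real.rpow_zero, lev, ← hq, ← hω]
      congr 1
      rw [mul_left_comm, ← Real.mul_rpow hj0'.le (by positivity)]
      congr 2
      push_cast
      field_simp
    rw [this, Real.mul_rpow (by positivity) (by positivity), ← Real.rpow_mul hj0'.le, one_div_mul_cancel hq0.ne', Real.rpow_one, hb]
    ring
  rw [hlev, Real.norm_of_nonneg (by positivity), Real.mul_rpow (by norm_num) (by positivity), mul_left_comm]
  gcongr
  rw [← Real.exp_mul, ← Real.exp_add, ← Real.exp_nat_mul]
  gcongr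
  nlinarith

lemma lev_zero {N : ℕ} (hN : 2 ≤ N) : lev N 0 = 1 := by
  have := q_gt_one hN
  unfold lev
  rw [Nat.cast_zero, mul_zero, Real.zero_rpow (by positivity)]
  simp

lemma lev_tendsto {N : ℕ} (hN : 2 ≤ N) : Tendsto (lev N) atTop atTop := by
  have := q_gt_one hN
  have hw := sphereVol_pos hN
  unfold lev
  apply tendsto_atTop_add_const_right
  apply Tendsto.const_mul_atTop (by positivity)
  exact (tendsto_rpow_atTop (by positivity)).comp (tendsto_natCast_atTop_atTop.const_mul_atTop hw)

lemma MT {N : ℕ} (hN : 2 ≤ N) {γ : ℝ} (hγ : 0 < γ) (hγ2 : γ < alphaMT N) :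
    ∃ C : ℝ≥0∞, C ≠ ⊤ ∧ ∀ u : EuclideanSpace ℝ (Fin N) → ℝ, IsTest (unitBall N) u →
      (∫⁻ y, ‖fderiv ℝ u y‖ₑ ^ (N:ℝ)) ≤ 1 →
      ∫⁻ x in unitBall N, ENNReal.ofReal (Real.exp (γ * |u x| ^ ((N:ℝ) / ((N:ℝ) - 1)))) ≤ C := by
  have hN1 : (2:ℝ) ≤ N := by exact_mod_cast hN
  have hw := sphereVol_pos hN
  have hq1 := q_gt_one hN
  have hsum := summable_lev hN hγ hγ2
  set q := (N:ℝ) / ((N:ℝ) - 1) with hq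
  set c : ℕ → ℝ := fun j => Real.exp (γ * lev N (j + 1) ^ q) with hc
  refine ⟨ENNReal.ofReal (Real.exp γ) * volume (unitBall N) +
    ∑' j : ℕ, ENNReal.ofReal (c j * (2 * Real.exp (-j)) ^ (N:ℝ)), ?_, ?_⟩
  · rw [← ENNReal.ofReal_tsum_of_nonneg (fun j => by positivity) hsum]
    apply ENNReal.add_ne_top.2 ⟨ENNReal.mul_ne_top (by simp) ?_, by simp⟩
    exact measure_ball_lt_top.ne
  intro u hu h1
  have hu1 : ContDiff ℝ 1 u := hu.1.of_le (by exact_mod_cast le_top)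
  have hcont : Continuous (fderiv ℝ u) := hu1.continuous_fderiv (by norm_num)
  set f : EuclideanSpace ℝ (Fin N) → ℝ≥0∞ := fun y => ‖fderiv ℝ u y‖ₑ with hf
  have hfm : Measurable f := by fun_prop
  set g : ℕ → EuclideanSpace ℝ (Fin N) → ℝ≥0∞ := fun j => nearPart f (2 * Real.exp (-j)) with hg
  have hgm : ∀ j, Measurable (g j) := fun j => measurable_nearPart hfm _
  set W := ENNReal.ofReal (sphereVol N) with hW
  have hW0 : W ≠ 0 := by simp [hW, hw]
  have hWt : W ≠ ⊤ := by simp [hW]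
  have hpt : ∀ x ∈ unitBall N, ENNReal.ofReal (Real.exp (γ * |u x| ^ q)) ≤
      ENNReal.ofReal (Real.exp γ) + ∑' j, ENNReal.ofReal (c j) * (g j x / W) ^ (N:ℝ) := by
    intro x hx
    by_cases hux : |u x| ≤ lev N 0
    · refine le_trans ?_ le_self_add
      rw [lev_zero hN] at hux
      apply ENNReal.ofReal_le_ofReal
      gcongr
      calc γ * |u x| ^ q ≤ γ * 1 ^ q := by gcongr
        _ = γ := by simp
    · obtain ⟨m, hm⟩ := ((lev_tendsto hN).eventually_ge_atTop |u x|).exists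
      classical
      have hex : ∃ m, |u x| ≤ lev N m := ⟨m, hm⟩
      obtain ⟨j, hj⟩ : ∃ j, Nat.find hex = j + 1 := by
        apply Nat.exists_eq_succ_of_ne_zero
        intro h0
        have := Nat.find_spec hex
        rw [h0] at this
        exact hux this
      have hj1 : |u x| ≤ lev N (j + 1) := by
        have := Nat.find_spec hex
        rwa [hj] at this
      have hj2 : lev N j < |u x| := by
        have := Nat.find_min hex (m := j) (by omega)
        exact not_le.1 this
      have hsb := split_bound hN hu h1 hx (δ := 2 * Real.exp (-j)) (by positivity)
        (by have : Real.exp (-(j:ℝ)) ≤ 1 := by simp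
            linarith)
      have hlog : Real.log (2 / (2 * Real.exp (-j))) = j := by
        rw [div_mul_cancel_left₀ (by norm_num), ← Real.exp_neg, neg_neg, Real.log_exp]
      rw [hlog, ← hq, ENNReal.ofReal_rpow_of_nonneg (by positivity) (by positivity)] at hsb
      have hge : W ≤ g j x := by
        have h2 : W * ENNReal.ofReal (lev N j) ≤ W * ‖u x‖ₑ := by
          gcongr
          rw [← ofReal_norm, Real.norm_eq_abs]
          exact ENNReal.ofReal_le_ofReal hj2.le
        have h3 := h2.trans hsb
        rw [hW, ← ENNReal.ofReal_mul hw.le, lev, ← hq, mul_add, mul_inv_cancel_left₀ hw.ne', mul_one,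
          ENNReal.ofReal_add (by positivity) hw.le, add_comm] at h3
        exact (ENNReal.add_le_add_iff_right (by simp)).1 h3
      refine le_trans ?_ le_add_self
      refine le_trans ?_ (ENNReal.le_tsum j)
      have h4 : 1 ≤ g j x / W := by
        rwa [ENNReal.le_div_iff_mul_le (Or.inl hW0) (Or.inl hWt), one_mul]
      calc ENNReal.ofReal (Real.exp (γ * |u x| ^ q)) ≤ ENNReal.ofReal (c j) * 1 := by
            rw [mul_one]
            apply ENNReal.ofReal_le_ofReal
            rw [hc]
            dsimp only
            gcongr
        _ ≤ _ := by
            gcongr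
            exact ENNReal.one_le_rpow h4 (by linarith)
  calc ∫⁻ x in unitBall N, ENNReal.ofReal (Real.exp (γ * |u x| ^ q))
      ≤ ∫⁻ x in unitBall N, (ENNReal.ofReal (Real.exp γ) + ∑' j, ENNReal.ofReal (c j) * (g j x / W) ^ (N:ℝ)) :=
        setLIntegral_mono' measurableSet_ball hpt
    _ = ENNReal.ofReal (Real.exp γ) * volume (unitBall N) +
        ∑' j, ∫⁻ x in unitBall N, ENNReal.ofReal (c j) * (g j x / W) ^ (N:ℝ) := by
        rw [lintegral_add_left measurable_const, setLIntegral_const, lintegral_tsum]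
        intro j
        have := hgm j
        fun_prop
    _ ≤ _ := by
        gcongr with j
        refine (setLIntegral_le_lintegral _ _).trans ?_
        rw [lintegral_const_mul' _ _ (by simp), ENNReal.ofReal_mul (by positivity)]
        gcongr
        simp_rw [div_eq_mul_inv, ENNReal.mul_rpow_of_nonneg _ _ (show (0:ℝ) ≤ N by positivity)]
        rw [lintegral_mul_const' _ _ (ENNReal.rpow_ne_top_of_nonneg (by positivity) (by simp [hW0]))]
        refine (mul_le_mul_left (nearPart_le hN hfm h1 _) _).trans ?_
        rw [← ENNReal.mul_rpow_of_nonneg _ _ (by positivity), ENNReal.ofReal_mul hw.le, mul_right_comm,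
          ENNReal.mul_inv_cancel hW0 hWt, one_mul, ENNReal.ofReal_rpow_of_nonneg (by positivity) (by positivity)]
end

section
open MeasureTheory Real Set Filter Topology
open scoped ENNReal

noncomputable def expTail (n : ℕ) (x : ℝ) : ℝ := Real.exp x - ∑ j ∈ Finset.range n, x ^ j / (Nat.factorial j : ℝ)

lemma expTail_eq_tsum (n : ℕ) (x : ℝ) : expTail n x = ∑' j : ℕ, x ^ (j + n) / ((j + n).factorial : ℝ) := by
  have h := (Real.summable_pow_div_factorial x).sum_add_tsum_nat_add n
  rw [expTail, Real.exp_eq_exp_ℝ, NormedSpace.exp_eq_tsum_div]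
  linarith

lemma expTail_mono (n : ℕ) {x y : ℝ} (hx : 0 ≤ x) (hxy : x ≤ y) : expTail n x ≤ expTail n y := by
  rw [expTail_eq_tsum, expTail_eq_tsum]
  refine Summable.tsum_le_tsum (fun j => ?_) ?_ ?_
  · gcongr
  · exact (summable_nat_add_iff n).2 (Real.summable_pow_div_factorial x)
  · exact (summable_nat_add_iff n).2 (Real.summable_pow_div_factorial y)

lemma expTail_nonneg (n : ℕ) {x : ℝ} (hx : 0 ≤ x) : 0 ≤ expTail n x := by
  rw [expTail_eq_tsum]
  exact tsum_nonneg fun j => by positivity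

lemma expTail_le_exp (n : ℕ) {x : ℝ} (hx : 0 ≤ x) : expTail n x ≤ Real.exp x := by
  unfold expTail
  have : 0 ≤ ∑ j ∈ Finset.range n, x ^ j / (Nat.factorial j : ℝ) := Finset.sum_nonneg fun j _ => by positivity
  linarith

lemma expTail_half (n : ℕ) : ∀ᶠ x in atTop, Real.exp x / 2 ≤ expTail n x := by
  have h : Tendsto (fun x : ℝ => ∑ j ∈ Finset.range n, (x ^ j * Real.exp (-x)) / (Nat.factorial j : ℝ)) atTop
      (𝓝 (∑ j ∈ Finset.range n, 0 / (Nat.factorial j : ℝ))) := by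
    apply tendsto_finsetSum
    intro j _
    exact (Real.tendsto_pow_mul_exp_neg_atTop_nhds_zero j).div_const _
  have h0 : ∑ j ∈ Finset.range n, (0:ℝ) / (Nat.factorial j : ℝ) = 0 := by simp
  rw [h0] at h
  filter_upwards [h.eventually (gt_mem_nhds (show (0:ℝ) < 1/2 by norm_num))] with x hx
  unfold expTail
  have : ∑ j ∈ Finset.range n, x ^ j / (Nat.factorial j : ℝ) =
      (∑ j ∈ Finset.range n, (x ^ j * Real.exp (-x)) / (Nat.factorial j : ℝ)) * Real.exp x := by
    rw [Finset.sum_mul]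
    apply Finset.sum_congr rfl
    intro j _
    rw [Real.exp_neg]
    field_simp
  rw [this]
  nlinarith [Real.exp_pos x]

lemma Phi_eq {N : ℕ} (γ t : ℝ) :
    PhiGamma N γ t = expTail (N - 1) (γ * |t| ^ ((N : ℝ) / ((N : ℝ) - 1))) := by
  unfold PhiGamma expTail
  congr 1
  apply Finset.sum_congr rfl
  intro j _
  rw [mul_pow, ← Real.rpow_natCast (|t| ^ _), ← Real.rpow_mul (abs_nonneg t)]
  congr 3
  ring

lemma Phi_nonneg {N : ℕ} {γ : ℝ} (hγ : 0 ≤ γ) (t : ℝ) : 0 ≤ PhiGamma N γ t := by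
  rw [Phi_eq]
  exact expTail_nonneg _ (by positivity)

lemma Phi_le_exp {N : ℕ} {γ : ℝ} (hγ : 0 ≤ γ) (t : ℝ) :
    PhiGamma N γ t ≤ Real.exp (γ * |t| ^ ((N : ℝ) / ((N : ℝ) - 1))) := by
  rw [Phi_eq]
  exact expTail_le_exp _ (by positivity)

lemma Phi_mono {N : ℕ} (hN : 2 ≤ N) {γ γ' t t' : ℝ} (hγ : 0 ≤ γ) (h : γ ≤ γ') (ht : 0 ≤ t) (htt : t ≤ t') :
    PhiGamma N γ t ≤ PhiGamma N γ' t' := by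
  have := q_gt_one hN
  rw [Phi_eq, Phi_eq, abs_of_nonneg ht, abs_of_nonneg (ht.trans htt)]
  have hγ' := hγ.trans h
  apply expTail_mono _ (by positivity)
  gcongr

lemma Phi_zero {N : ℕ} (hN : 2 ≤ N) (γ : ℝ) : PhiGamma N γ 0 = 0 := by
  have := q_gt_one hN
  rw [Phi_eq, abs_zero, Real.zero_rpow (by positivity), mul_zero, expTail]
  obtain ⟨m, hm⟩ : ∃ m, N - 1 = m + 1 := ⟨N - 2, by omega⟩
  rw [hm, Finset.sum_range_succ']
  simp

lemma Phi_continuous {N : ℕ} (hN : 2 ≤ N) (γ : ℝ) : Continuous (PhiGamma N γ) := by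
  have := q_gt_one hN
  have e : PhiGamma N γ = fun t => expTail (N - 1) (γ * |t| ^ ((N : ℝ) / ((N : ℝ) - 1))) := funext (Phi_eq γ)
  rw [e]
  unfold expTail
  have h : Continuous fun t : ℝ => γ * |t| ^ ((N : ℝ) / ((N : ℝ) - 1)) :=
    continuous_const.mul (continuous_abs.rpow_const (fun _ => Or.inr (by positivity)))
  fun_prop

lemma energy_conv {N : ℕ} (hN : 2 ≤ N) {u : EuclideanSpace ℝ (Fin N) → ℝ} (hu : IsTest (unitBall N) u) :
    ENNReal.ofReal (∫ x in unitBall N, ‖fderiv ℝ u x‖ ^ N) = ∫⁻ y, ‖fderiv ℝ u y‖ₑ ^ (N:ℝ) := by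
  have hu1 : ContDiff ℝ 1 u := hu.1.of_le (by exact_mod_cast le_top)
  have hcont : Continuous (fderiv ℝ u) := hu1.continuous_fderiv (by norm_num)
  have hcs : HasCompactSupport (fderiv ℝ u) := hu.2.1.fderiv ℝ
  have e : ∫ x in unitBall N, ‖fderiv ℝ u x‖ ^ N = ∫ x, ‖fderiv ℝ u x‖ ^ N := by
    apply setIntegral_eq_integral_of_forall_compl_eq_zero
    intro x hx
    have : fderiv ℝ u x = 0 := by
      apply image_eq_zero_of_notMem_tsupport
      intro h
      exact hx (hu.2.2 (tsupport_fderiv_subset ℝ h))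
    rw [this, norm_zero, zero_pow (by omega)]
  rw [e, ofReal_integral_eq_lintegral_ofReal]
  · congr 1
    ext y
    rw [ENNReal.rpow_natCast, ← ofReal_norm, ENNReal.ofReal_pow (norm_nonneg _)]
  · apply Continuous.integrable_of_hasCompactSupport (by fun_prop)
    apply hcs.norm.comp_left (g := fun t : ℝ => t ^ N)
    simp; omega
  · exact Eventually.of_forall fun y => by positivity

lemma upper {N : ℕ} (hN : 2 ≤ N) {γ p s : ℝ} (hγ : 0 < γ) (hps : p.HolderConjugate s)
    (hp : p * γ < alphaMT N) (w : EuclideanSpace ℝ (Fin N) → ℝ) (hw : ∀ x ∈ unitBall N, 0 ≤ w x)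
    (hwm : ContinuousOn w (unitBall N))
    (hws : ∫⁻ x in unitBall N, ENNReal.ofReal (w x) ^ s ≠ ⊤) :
    BddAbove {s : ℝ | ∃ u : EuclideanSpace ℝ (Fin N) → ℝ, IsTest (unitBall N) u ∧
            (∫ x in unitBall N, ‖fderiv ℝ u x‖ ^ N) ≤ 1 ∧
            s = ∫ x in unitBall N, PhiGamma N γ (u x) * w x} := by
  obtain ⟨C, hC, hMT⟩ := MT hN (γ := p * γ) (mul_pos hps.pos hγ) hp
  refine ⟨(C ^ (1 / p) * (∫⁻ x in unitBall N, ENNReal.ofReal (w x) ^ s) ^ (1 / s)).toReal, ?_⟩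
  rintro _ ⟨u, hu, hE, rfl⟩
  have hE' : ∫⁻ y, ‖fderiv ℝ u y‖ₑ ^ (N:ℝ) ≤ 1 := by
    rw [← energy_conv hN hu]
    exact ENNReal.ofReal_le_one.2 hE
  refine (le_norm_self _).trans ((norm_integral_le_lintegral_norm _).trans ?_)
  apply ENNReal.toReal_mono
  · exact ENNReal.mul_ne_top (ENNReal.rpow_ne_top_of_nonneg (one_div_nonneg.2 hps.nonneg) hC)
      (ENNReal.rpow_ne_top_of_nonneg (one_div_nonneg.2 hps.symm.nonneg) hws)
  have hq1 := q_gt_one hN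
  set q := (N:ℝ) / ((N:ℝ) - 1) with hq
  have hum : Measurable u := hu.1.continuous.measurable
  calc ∫⁻ x in unitBall N, ENNReal.ofReal ‖PhiGamma N γ (u x) * w x‖
      ≤ ∫⁻ x in unitBall N, ((fun x => ENNReal.ofReal (Real.exp (γ * |u x| ^ q))) *
          (fun x => ENNReal.ofReal (w x)) : EuclideanSpace ℝ (Fin N) → ℝ≥0∞) x := by
        apply setLIntegral_mono' measurableSet_ball
        intro x hx
        simp only [Pi.mul_apply]
        rw [← ENNReal.ofReal_mul (by positivity),
          Real.norm_of_nonneg (mul_nonneg (Phi_nonneg hγ.le _) (hw x hx))]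
        apply ENNReal.ofReal_le_ofReal
        exact mul_le_mul_of_nonneg_right (Phi_le_exp hγ.le _) (hw x hx)
    _ ≤ _ := ENNReal.lintegral_mul_le_Lp_mul_Lq _ hps (by fun_prop)
          ((hwm.aemeasurable measurableSet_ball).ennreal_ofReal)
    _ ≤ _ := by
        have hmono : ∫⁻ x in unitBall N, ENNReal.ofReal (Real.exp (γ * |u x| ^ q)) ^ p ≤ C := by
          refine le_trans (le_of_eq ?_) (hMT u hu hE')
          congr 1
          ext x
          rw [ENNReal.ofReal_rpow_of_nonneg (by positivity) hps.nonneg, ← Real.exp_mul]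
          congr 2
          ring
        have := one_div_nonneg.2 hps.nonneg
        gcongr
end

section
open MeasureTheory Real Set Filter Topology
open scoped ENNReal ContDiff

noncomputable def ramp (s : ℝ) : ℝ := ∫ τ in (0:ℝ)..s, Real.smoothTransition τ

lemma ramp_hasDerivAt (s : ℝ) : HasDerivAt ramp (Real.smoothTransition s) s :=
  (Real.smoothTransition.continuous).integral_hasStrictDerivAt 0 s |>.hasDerivAt

lemma ramp_contDiff : ContDiff ℝ ∞ ramp := by
  rw [contDiff_infty_iff_deriv]
  refine ⟨fun s => (ramp_hasDerivAt s).differentiableAt, ?_⟩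
  have : deriv ramp = Real.smoothTransition := funext fun s => (ramp_hasDerivAt s).deriv
  rw [this]
  exact Real.smoothTransition.contDiff

lemma ramp_zero {s : ℝ} (hs : s ≤ 0) : ramp s = 0 := by
  unfold ramp
  rw [intervalIntegral.integral_congr (g := fun _ => (0:ℝ))]
  · simp
  intro τ hτ
  rw [uIcc_of_ge hs] at hτ
  exact Real.smoothTransition.zero_of_nonpos hτ.2

lemma ramp_ge {s : ℝ} (hs : 1 ≤ s) : s - 1 ≤ ramp s := by
  have hi : ∀ a b : ℝ, IntervalIntegrable Real.smoothTransition volume a b :=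
    fun a b => Real.smoothTransition.continuous.intervalIntegrable a b
  unfold ramp
  rw [← intervalIntegral.integral_add_adjacent_intervals (hi 0 1) (hi 1 s)]
  have h1 : 0 ≤ ∫ τ in (0:ℝ)..1, Real.smoothTransition τ :=
    intervalIntegral.integral_nonneg (by norm_num) fun τ _ => Real.smoothTransition.nonneg τ
  have h2 : ∫ τ in (1:ℝ)..s, Real.smoothTransition τ = s - 1 := by
    rw [intervalIntegral.integral_congr (g := fun _ => (1:ℝ))]
    · simp
    intro τ hτ
    rw [uIcc_of_le hs] at hτ
    exact Real.smoothTransition.one_of_one_le hτ.1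
  linarith

noncomputable def moserFn {N : ℕ} (x₀ : EuclideanSpace ℝ (Fin N)) (d δ : ℝ) (x : EuclideanSpace ℝ (Fin N)) : ℝ :=
  ramp (Real.log d - 1 / 2 * Real.log (‖x - x₀‖ ^ 2 + δ ^ 2))

section
variable {N : ℕ} (x₀ : EuclideanSpace ℝ (Fin N)) {d δ : ℝ}

lemma moserFn_contDiff (hδ : 0 < δ) : ContDiff ℝ ∞ (moserFn x₀ d δ) := by
  unfold moserFn
  apply ramp_contDiff.comp
  apply contDiff_const.sub
  apply contDiff_const.mul
  apply ContDiff.log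
  · exact ((contDiff_id.sub contDiff_const).norm_sq ℝ).add contDiff_const
  · intro x
    positivity

lemma moserFn_zero (hd : 0 < d) (_hδ : 0 < δ) {x : EuclideanSpace ℝ (Fin N)} (hx : d < ‖x - x₀‖) :
    moserFn x₀ d δ x = 0 := by
  apply ramp_zero
  have h1 : Real.log (d ^ 2) ≤ Real.log (‖x - x₀‖ ^ 2 + δ ^ 2) := by
    apply Real.log_le_log (by positivity)
    nlinarith [sq_nonneg δ]
  rw [Real.log_pow] at h1
  push_cast at h1
  linarith

lemma moserFn_tsupport (hd : 0 < d) (hδ : 0 < δ) :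
    tsupport (moserFn x₀ d δ) ⊆ Metric.closedBall x₀ d := by
  apply closure_minimal _ Metric.isClosed_closedBall
  intro x hx
  by_contra h
  apply hx
  apply moserFn_zero x₀ hd hδ
  rw [Metric.mem_closedBall, dist_eq_norm] at h
  exact not_le.1 h

lemma moserFn_ge (hd : 0 < d) (hδ : 0 < δ) (h2 : 2 ≤ Real.log (d / δ)) {x : EuclideanSpace ℝ (Fin N)}
    (hx : ‖x - x₀‖ ≤ δ) : Real.log (d / δ) - 2 ≤ moserFn x₀ d δ x := by
  have h1 : Real.log (‖x - x₀‖ ^ 2 + δ ^ 2) ≤ Real.log 2 + 2 * Real.log δ := by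
    have : Real.log 2 + 2 * Real.log δ = Real.log (2 * δ ^ 2) := by
      rw [Real.log_mul (by norm_num) (by positivity), Real.log_pow]; push_cast; ring
    rw [this]
    apply Real.log_le_log (by positivity)
    nlinarith [norm_nonneg (x - x₀)]
  have h3 : Real.log 2 ≤ 1 := by linarith [Real.log_two_lt_d9]
  rw [Real.log_div hd.ne' hδ.ne'] at *
  unfold moserFn
  refine le_trans ?_ (ramp_ge ?_) <;> linarith

lemma moserFn_fderiv (hδ : 0 < δ) (x : EuclideanSpace ℝ (Fin N)) :
    ‖fderiv ℝ (moserFn x₀ d δ) x‖ ≤ ‖x - x₀‖ / (‖x - x₀‖ ^ 2 + δ ^ 2) := by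
  have hpos : 0 < ‖x - x₀‖ ^ 2 + δ ^ 2 := by positivity
  have h1 : HasFDerivAt (fun x : EuclideanSpace ℝ (Fin N) => ‖x - x₀‖ ^ 2 + δ ^ 2)
      (2 • (innerSL ℝ (x - x₀))) x := by
    have := ((hasFDerivAt_id x).sub_const x₀).norm_sq
    simpa using this.add_const (δ ^ 2)
  have h2 := ((h1.log hpos.ne').const_mul (1 / 2)).const_sub (Real.log d)
  have h3 := (ramp_hasDerivAt (Real.log d - 1 / 2 * Real.log (‖x - x₀‖ ^ 2 + δ ^ 2))).comp_hasFDerivAt x h2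
  have h4 : fderiv ℝ (moserFn x₀ d δ) x = _ := h3.fderiv
  rw [h4, norm_smul, norm_neg, norm_smul, norm_smul]
  have h5 : ‖(2 : ℕ) • (innerSL ℝ (x - x₀))‖ ≤ 2 * ‖x - x₀‖ := by
    refine (norm_nsmul_le (n := 2)).trans ?_
    rw [innerSL_apply_norm]
    norm_num
  have h6 : ‖Real.smoothTransition (Real.log d - 1 / 2 * Real.log (‖x - x₀‖ ^ 2 + δ ^ 2))‖ ≤ 1 := by
    rw [Real.norm_of_nonneg (Real.smoothTransition.nonneg _)]
    exact Real.smoothTransition.le_one _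
  calc _ ≤ 1 * (‖(1 / 2 : ℝ)‖ * (‖(‖x - x₀‖ ^ 2 + δ ^ 2)⁻¹‖ * (2 * ‖x - x₀‖))) := by gcongr
    _ = _ := by
      rw [Real.norm_of_nonneg (by positivity : (0:ℝ) ≤ 1 / 2), Real.norm_of_nonneg (by positivity)]
      field_simp

lemma moserFn_energy (hN : 2 ≤ N) (hδ : 0 < δ) (hδd : δ ≤ d) :
    ∫⁻ x, ‖fderiv ℝ (moserFn x₀ d δ) x‖ₑ ^ (N:ℝ) ≤
      ENNReal.ofReal (sphereVol N * Real.log (d / δ)) + volume (Metric.ball (0 : EuclideanSpace ℝ (Fin N)) 1) := by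
  have hd : 0 < d := hδ.trans_le hδd
  have hN1 : (2:ℝ) ≤ N := by exact_mod_cast hN
  rw [← lintegral_add_right_eq_self _ x₀]
  have hpt : ∀ z, ‖fderiv ℝ (moserFn x₀ d δ) (z + x₀)‖ₑ ^ (N:ℝ) ≤
      ((Ioc δ d).indicator (rieszK N) ‖z‖) ^ ((N:ℝ) / ((N:ℝ) - 1)) +
        (Metric.closedBall (0 : EuclideanSpace ℝ (Fin N)) δ).indicator (fun _ => ENNReal.ofReal δ⁻¹ ^ (N:ℝ)) z := by
    intro z
    have hb := moserFn_fderiv x₀ (d := d) hδ (z + x₀)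
    rw [add_sub_cancel_right] at hb
    by_cases h1 : ‖z‖ ≤ δ
    · refine le_trans ?_ le_add_self
      rw [indicator_of_mem (by simpa using h1)]
      gcongr
      rw [← ofReal_norm]
      apply ENNReal.ofReal_le_ofReal
      refine hb.trans ?_
      rw [div_le_iff₀ (by positivity)]
      have : δ⁻¹ * (‖z‖ ^ 2 + δ ^ 2) = δ⁻¹ * ‖z‖ ^ 2 + δ := by field_simp
      rw [this]
      have : 0 ≤ δ⁻¹ * ‖z‖ ^ 2 := by positivity
      linarith
    · push Not at h1
      have hz : 0 < ‖z‖ := hδ.trans h1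
      by_cases h2 : ‖z‖ ≤ d
      · refine le_trans ?_ le_self_add
        rw [indicator_of_mem (show ‖z‖ ∈ Ioc δ d from ⟨h1, h2⟩), rieszK]
        have e : (ENNReal.ofReal (‖z‖ ^ (N - 1)))⁻¹ ^ ((N:ℝ) / ((N:ℝ) - 1)) = ENNReal.ofReal (‖z‖⁻¹) ^ (N:ℝ) := by
          rw [ENNReal.ofReal_pow hz.le, ← ENNReal.rpow_natCast, ENNReal.ofReal_inv_of_pos hz, ← ENNReal.inv_rpow,
            ← ENNReal.rpow_mul]
          congr 1
          rw [Nat.cast_sub (by omega)]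
          have : (N:ℝ) - 1 ≠ 0 := by linarith
          push_cast
          field_simp
        rw [e]
        gcongr
        rw [← ofReal_norm]
        apply ENNReal.ofReal_le_ofReal
        refine hb.trans ?_
        rw [div_le_iff₀ (by positivity)]
        have : ‖z‖⁻¹ * (‖z‖ ^ 2 + δ ^ 2) = ‖z‖ + ‖z‖⁻¹ * δ ^ 2 := by field_simp
        rw [this]
        have : 0 ≤ ‖z‖⁻¹ * δ ^ 2 := by positivity
        linarith
      · have h0 : fderiv ℝ (moserFn x₀ d δ) (z + x₀) = 0 := by
          apply image_eq_zero_of_notMem_tsupport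
          intro h
          have := moserFn_tsupport x₀ hd hδ (tsupport_fderiv_subset ℝ h)
          rw [Metric.mem_closedBall, dist_eq_norm, add_sub_cancel_right] at this
          exact h2 this
        have h00 : ‖fderiv ℝ (moserFn x₀ d δ) (z + x₀)‖ₑ = 0 := by
          rw [← ofReal_norm, h0, norm_zero, ENNReal.ofReal_zero]
        rw [h00, ENNReal.zero_rpow_of_pos (by linarith)]
        exact zero_le
  refine (lintegral_mono hpt).trans ?_
  have hk2 : Measurable ((Ioc δ d).indicator (rieszK N)) := (measurable_rieszK N).indicator measurableSet_Ioc
  rw [lintegral_add_left (by fun_prop), far_ker hN hδ hδd]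
  gcongr
  rw [lintegral_indicator_const Metric.isClosed_closedBall.measurableSet, Measure.addHaar_closedBall _ _ hδ.le,
    finrank_euclideanSpace, Fintype.card_fin, ENNReal.ofReal_rpow_of_nonneg (by positivity) (by positivity),
    ← mul_assoc, ← ENNReal.ofReal_mul (by positivity), Real.rpow_natCast, ← mul_pow, inv_mul_cancel₀ hδ.ne']
  simp
end
end

section
open MeasureTheory Real Set Filter Topology
open scoped ENNReal ContDiff

noncomputable def tval (N : ℕ) (V y : ℝ) : ℝ := (y - 2) / (V + sphereVol N * y) ^ (1 / (N:ℝ))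

lemma tval_asym {N : ℕ} (hN : 2 ≤ N) {V α θ : ℝ} (hV : 0 < V)
    (hθ : θ < α * (N / alphaMT N)) :
    ∀ᶠ y in atTop, θ * y ≤ α * |tval N V y| ^ ((N:ℝ) / ((N:ℝ) - 1)) := by
  have hN1 : (2:ℝ) ≤ N := by exact_mod_cast hN
  have hw := sphereVol_pos hN
  have hq1 := q_gt_one hN
  have hid := const_id hN
  have hpq := (holderN hN).inv_add_inv_eq_one
  set q := (N:ℝ) / ((N:ℝ) - 1) with hq
  set σ := sphereVol N with hσ
  have hq0 : 0 < q := by linarith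
  have hlim : Tendsto (fun y : ℝ => α * ((1 - 2 * y⁻¹) / (V * y⁻¹ + σ) ^ (1 / (N:ℝ))) ^ q) atTop
      (𝓝 (α * ((1 - 2 * 0) / (V * 0 + σ) ^ (1 / (N:ℝ))) ^ q)) := by
    refine Tendsto.const_mul _ (Tendsto.rpow_const (Tendsto.div ?_ ?_ ?_) (Or.inr hq0.le))
    · exact (tendsto_inv_atTop_zero.const_mul 2).const_sub 1
    · exact ((tendsto_inv_atTop_zero.const_mul V).add_const σ).rpow_const (Or.inr (by positivity))
    · simp only [mul_zero, zero_add]; positivity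
  have hval : α * ((1 - 2 * 0) / (V * 0 + σ) ^ (1 / (N:ℝ))) ^ q = α * (N / alphaMT N) := by
    rw [← hid]
    congr 2
    rw [mul_zero, mul_zero, sub_zero, zero_add, one_div, ← Real.rpow_neg hw.le, ← Real.rpow_neg_one σ, ← Real.rpow_add hw]
    congr 1
    simp only [one_div]
    linarith
  rw [hval] at hlim
  filter_upwards [hlim.eventually (lt_mem_nhds hθ), eventually_gt_atTop 2] with y hy hy2
  have hy0 : 0 < y := by linarith
  have hyi : 2 * y⁻¹ ≤ 1 := by rw [← div_eq_mul_inv, div_le_one hy0]; exact hy2.le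
  have e : tval N V y = y ^ (1 / q) * ((1 - 2 * y⁻¹) / (V * y⁻¹ + σ) ^ (1 / (N:ℝ))) := by
    have e1 : V + σ * y = y * (V * y⁻¹ + σ) := by field_simp
    rw [tval, ← hσ, e1, Real.mul_rpow hy0.le (by positivity)]
    have e2 : y ^ (1 / q) = y / y ^ (1 / (N:ℝ)) := by
      rw [eq_div_iff (by positivity), ← Real.rpow_add hy0]
      have : 1 / q + 1 / (N:ℝ) = 1 := by simp only [one_div]; linarith
      rw [this, Real.rpow_one]
    rw [e2, div_mul_div_comm]
    congr 1
    field_simp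
  have hnn : 0 ≤ (1 - 2 * y⁻¹) / (V * y⁻¹ + σ) ^ (1 / (N:ℝ)) := by
    apply div_nonneg (by linarith)
    positivity
  rw [e, abs_of_nonneg (by positivity), Real.mul_rpow (by positivity) hnn, ← Real.rpow_mul hy0.le,
    one_div_mul_cancel hq0.ne', Real.rpow_one]
  nlinarith

lemma Phi_asym {N : ℕ} (hN : 2 ≤ N) {V α β K : ℝ} (hV : 0 < V) (hβ0 : 0 ≤ β)
    (hβ : β < α / alphaMT N) :
    ∀ᶠ y in atTop, K * Real.exp (N * β * y) ≤ PhiGamma N α (tval N V y) := by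
  have hN1 : (2:ℝ) ≤ N := by exact_mod_cast hN
  have h1 : N * β < α * (N / alphaMT N) := by
    calc N * β < N * (α / alphaMT N) := by gcongr
      _ = _ := by ring
  obtain ⟨θ, hθ1, hθ2⟩ := exists_between h1
  have hθ0 : 0 < θ := lt_of_le_of_lt (by positivity) hθ1
  have h2 := tval_asym hN hV hθ2
  have h3 : Tendsto (fun y => α * |tval N V y| ^ ((N:ℝ) / ((N:ℝ) - 1))) atTop atTop :=
    tendsto_atTop_mono' _ h2 (tendsto_id.const_mul_atTop hθ0)
  have h4 := h3.eventually (expTail_half (N - 1))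
  have h5 : Tendsto (fun y => Real.exp ((θ - N * β) * y)) atTop atTop :=
    Real.tendsto_exp_atTop.comp (tendsto_id.const_mul_atTop (by linarith))
  filter_upwards [h2, h4, h5.eventually_ge_atTop (2 * K)] with y hy2 hy4 hy5
  rw [Phi_eq]
  refine le_trans ?_ hy4
  have h6 : Real.exp (θ * y) ≤ Real.exp (α * |tval N V y| ^ ((N:ℝ) / ((N:ℝ) - 1))) := Real.exp_le_exp.2 hy2
  have h7 : Real.exp (θ * y) = Real.exp ((θ - N * β) * y) * Real.exp (N * β * y) := by
    rw [← Real.exp_add]; congr 1; ring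
  have := Real.exp_pos (N * β * y)
  nlinarith

lemma bump {N : ℕ} (hN : 2 ≤ N) {α s d ε K : ℝ} (_hα : 0 < α) (hs : 1 ≤ s)
    (hsα : s * (1 - α / alphaMT N) < 1) (hd : 0 < d) (hε : 0 < ε)
    (x₀ : EuclideanSpace ℝ (Fin N)) :
    ∃ δ M t : ℝ, ∃ u : EuclideanSpace ℝ (Fin N) → ℝ, 0 < δ ∧ 2 * δ ≤ d ∧ 0 ≤ M ∧ 0 ≤ t ∧
      ContDiff ℝ ∞ u ∧ tsupport u ⊆ Metric.closedBall x₀ d ∧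
      ∫⁻ x, ‖fderiv ℝ u x‖ₑ ^ (N:ℝ) ≤ 1 ∧ (∀ x ∈ Metric.ball x₀ δ, t ≤ u x) ∧
      K ≤ M * volume.real (Metric.ball x₀ δ) * PhiGamma N α t ∧
      ENNReal.ofReal ((1 + M) ^ s) * volume (Metric.ball x₀ (2 * δ)) ≤ ENNReal.ofReal ε := by
  have hN1 : (2:ℝ) ≤ N := by exact_mod_cast hN
  have hw := sphereVol_pos hN
  set V := volume.real (Metric.ball (0 : EuclideanSpace ℝ (Fin N)) 1) with hVdef
  have hVe : volume (Metric.ball (0 : EuclideanSpace ℝ (Fin N)) 1) = ENNReal.ofReal V := by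
    rw [hVdef, measureReal_def, ENNReal.ofReal_toReal measure_ball_lt_top.ne]
  have hV : 0 < V := by
    rw [hVdef, measureReal_def]
    exact ENNReal.toReal_pos (Metric.measure_ball_pos _ _ one_pos).ne' measure_ball_lt_top.ne
  have hvol : ∀ r : ℝ, 0 < r → volume (Metric.ball x₀ r) = ENNReal.ofReal (r ^ N * V) := by
    intro r hr
    rw [Measure.addHaar_ball_of_pos _ _ hr, hVe, finrank_euclideanSpace, Fintype.card_fin, ← ENNReal.ofReal_mul (by positivity)]
  have hs0 : 0 < s := by linarith
  have hb : 1 - 1 / s < α / alphaMT N := by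
    have : 1 - α / alphaMT N < 1 / s := by rw [lt_div_iff₀ hs0]; linarith
    linarith
  obtain ⟨β, hβ1, hβ2⟩ := exists_between hb
  have hβ0 : 0 ≤ β := by
    have : 1 / s ≤ 1 := by rw [div_le_one hs0]; exact hs
    linarith
  have hsβ : s * (1 - β) < 1 := by
    have : 1 - β < 1 / s := by linarith
    rw [lt_div_iff₀ hs0] at this; linarith
  have hβlt : β ≤ 1 ∨ 1 < β := le_or_gt _ _
  have hPhi := Phi_asym hN (K := K / (V * d ^ N)) hV hβ0 hβ2
  set C := (2:ℝ) ^ N * d ^ N * V with hC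
  have hsmall : Tendsto (fun y : ℝ => (1 + Real.exp (N * (1 - β) * y)) ^ s * ((2 * (d * Real.exp (-y))) ^ N * V)) atTop (𝓝 0) := by
    have h1 : Tendsto (fun y : ℝ => (Real.exp (-(N / s) * y) + Real.exp ((N * (1 - β) - N / s) * y)) ^ s * C) atTop
        (𝓝 ((0 + 0) ^ s * C)) := by
      refine Tendsto.mul_const _ (Tendsto.rpow_const (Tendsto.add ?_ ?_) (Or.inr hs0.le))
      · apply Real.tendsto_exp_atBot.comp
        apply tendsto_id.const_mul_atTop_of_neg
        have : 0 < N / s := by positivity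
        linarith
      · apply Real.tendsto_exp_atBot.comp
        apply tendsto_id.const_mul_atTop_of_neg
        have : 1 - β < 1 / s := by linarith
        have h3 : (N:ℝ) * (1 - β) < N * (1 / s) := by gcongr
        have : (N:ℝ) * (1 / s) = N / s := by ring
        linarith
    rw [add_zero, Real.zero_rpow hs0.ne', zero_mul] at h1
    refine h1.congr (fun y => ?_)
    have e1 : Real.exp (-(N / s) * y) + Real.exp ((N * (1 - β) - N / s) * y) =
        (1 + Real.exp (N * (1 - β) * y)) * Real.exp (-(N / s) * y) := by
      rw [add_mul, one_mul, ← Real.exp_add]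
      congr 2
      ring
    rw [e1, Real.mul_rpow (by positivity) (by positivity), ← Real.exp_mul, hC, mul_pow, mul_pow, ← Real.exp_nat_mul]
    have : -(N / s) * y * s = N * -y := by field_simp
    rw [this]
    ring
  obtain ⟨y, hy1, hy2, hy3⟩ := (hPhi.and ((hsmall.eventually (gt_mem_nhds hε)).and (eventually_ge_atTop (2:ℝ)))).exists
  set δ := d * Real.exp (-y) with hδdef
  have hδ : 0 < δ := by positivity
  have h2δ : 2 * δ ≤ d := by
    have : Real.exp (-y) ≤ 1 / 2 := by
      rw [Real.exp_neg, inv_eq_one_div]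
      apply one_div_le_one_div_of_le (by norm_num)
      linarith [Real.add_one_le_exp y]
    nlinarith
  have hlog : Real.log (d / δ) = y := by
    rw [hδdef, div_mul_cancel_left₀ hd.ne', ← Real.exp_neg, neg_neg, Real.log_exp]
  have hE : 0 < V + sphereVol N * y := by positivity
  set c := (V + sphereVol N * y) ^ (-(1 / (N:ℝ))) with hc
  have hc0 : 0 < c := by positivity
  have ht : tval N V y = c * (y - 2) := by
    rw [tval, hc, Real.rpow_neg hE.le]; field_simp
  refine ⟨δ, Real.exp (N * (1 - β) * y), tval N V y, fun x => c * moserFn x₀ d δ x, hδ, h2δ, by positivity, ?_,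
    ?_, ?_, ?_, ?_, ?_, ?_⟩
  · rw [ht]
    apply mul_nonneg hc0.le; linarith
  · exact contDiff_const.mul (moserFn_contDiff x₀ hδ)
  · refine (closure_mono ?_).trans (moserFn_tsupport x₀ hd hδ)
    intro x hx hx'
    apply hx
    show c * moserFn x₀ d δ x = 0
    rw [hx', mul_zero]
  · have e : ∀ x, ‖fderiv ℝ (fun x => c * moserFn x₀ d δ x) x‖ₑ ^ (N:ℝ) =
        ENNReal.ofReal (V + sphereVol N * y)⁻¹ * ‖fderiv ℝ (moserFn x₀ d δ) x‖ₑ ^ (N:ℝ) := by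
      intro x
      rw [fderiv_const_mul ((moserFn_contDiff x₀ hδ).differentiable (by simp) x)]
      rw [← ofReal_norm, norm_smul, ENNReal.ofReal_mul (norm_nonneg _), ENNReal.mul_rpow_of_nonneg _ _ (by positivity),
        ofReal_norm (fderiv ℝ (moserFn x₀ d δ) x)]
      congr 1
      rw [Real.norm_of_nonneg hc0.le, ENNReal.ofReal_rpow_of_nonneg hc0.le (by positivity), hc, ← Real.rpow_mul hE.le,
        ← Real.rpow_neg_one]
      congr 2
      field_simp
    simp_rw [e]
    rw [lintegral_const_mul' _ _ (by simp)]
    refine (mul_le_mul_right (moserFn_energy x₀ hN hδ (by linarith)) _).trans ?_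
    rw [hlog, hVe, ← ENNReal.ofReal_add (by positivity) hV.le, ← ENNReal.ofReal_mul (by positivity), add_comm (sphereVol N * y),
      inv_mul_cancel₀ hE.ne', ENNReal.ofReal_one]
  · intro x hx
    rw [ht]
    apply mul_le_mul_of_nonneg_left _ hc0.le
    have := moserFn_ge x₀ hd hδ (by rw [hlog]; exact hy3) (x := x) (by rw [← dist_eq_norm]; exact (Metric.mem_ball.1 hx).le)
    rwa [hlog] at this
  · rw [measureReal_def, hvol δ hδ, ENNReal.toReal_ofReal (by positivity)]
    calc K = Real.exp (N * (1 - β) * y) * (δ ^ N * V) * (K / (V * d ^ N) * Real.exp (N * β * y)) := by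
          have : δ ^ N = d ^ N * Real.exp (N * -y) := by rw [hδdef, mul_pow, ← Real.exp_nat_mul]
          rw [this]
          have h1 : Real.exp (N * (1 - β) * y) * Real.exp (N * -y) * Real.exp (N * β * y) = 1 := by
            rw [← Real.exp_add, ← Real.exp_add, Real.exp_eq_one_iff]; ring
          calc K = (Real.exp (N * (1 - β) * y) * Real.exp (N * -y) * Real.exp (N * β * y)) * K := by rw [h1, one_mul]
            _ = _ := by field_simp
      _ ≤ _ := by gcongr
  · rw [hvol _ (by positivity), ← ENNReal.ofReal_mul (by positivity)]
    exact ENNReal.ofReal_le_ofReal hy2.le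
end

section
open MeasureTheory Real Set Filter Topology
open scoped ENNReal ContDiff

noncomputable def cutoff {N : ℕ} (x₀ : EuclideanSpace ℝ (Fin N)) (δ : ℝ) (y : EuclideanSpace ℝ (Fin N)) : ℝ :=
  max 0 (min 1 (2 - dist y x₀ / δ))

lemma weight_exists {N : ℕ} (x : ℕ → EuclideanSpace ℝ (Fin N)) (δ M : ℕ → ℝ) (hδ : ∀ k, 0 < δ k)
    (hM : ∀ k, 0 ≤ M k)
    (hloc : ∀ k y, dist y (x k) < 2 * δ k → 3 / 8 * (1 / 2 : ℝ) ^ k < 1 - ‖y‖ ∧ 1 - ‖y‖ < 5 / 8 * (1 / 2 : ℝ) ^ k) :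
    ∃ w : EuclideanSpace ℝ (Fin N) → ℝ, ContinuousOn w (unitBall N) ∧ (∀ y, 1 ≤ w y) ∧
      (∀ k, ∀ y ∈ Metric.ball (x k) (δ k), M k ≤ w y) ∧
      ∀ y, w y = 1 ∨ ∃ k, y ∈ Metric.ball (x k) (2 * δ k) ∧ w y ≤ 1 + M k := by
  have hnz : ∀ k y, cutoff (x k) (δ k) y ≠ 0 → dist y (x k) < 2 * δ k := by
    intro k y h
    by_contra hc
    apply h
    rw [cutoff, max_eq_left]
    apply (min_le_right _ _).trans
    have : 2 ≤ dist y (x k) / δ k := by rw [le_div_iff₀ (hδ k)]; linarith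
    linarith
  have hz : ∀ k y, 1 - ‖y‖ ≤ 3 / 8 * (1 / 2 : ℝ) ^ k ∨ 5 / 8 * (1 / 2 : ℝ) ^ k ≤ 1 - ‖y‖ → cutoff (x k) (δ k) y = 0 := by
    intro k y h
    by_contra hc
    have := hloc k y (hnz k y hc)
    rcases h with h | h <;> linarith
  have hcont : ∀ k, Continuous (cutoff (x k) (δ k)) := by
    intro k; unfold cutoff; fun_prop
  have h0 : ∀ k y, 0 ≤ cutoff (x k) (δ k) y := fun k y => le_max_left _ _
  have h1 : ∀ k y, cutoff (x k) (δ k) y ≤ 1 := fun k y => max_le zero_le_one (min_le_left _ _)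
  have hone : ∀ k, ∀ y ∈ Metric.ball (x k) (δ k), cutoff (x k) (δ k) y = 1 := by
    intro k y hy
    have : dist y (x k) / δ k ≤ 1 := by rw [div_le_one (hδ k)]; exact (Metric.mem_ball.1 hy).le
    rw [cutoff, min_eq_left (by linarith), max_eq_right zero_le_one]
  have hpair : ∀ k l : ℕ, k < l → (1 / 2 : ℝ) ^ l ≤ (1 / 2 : ℝ) ^ k / 2 := by
    intro k l h
    calc (1 / 2 : ℝ) ^ l ≤ (1 / 2) ^ (k + 1) := pow_le_pow_of_le_one (by norm_num) (by norm_num) h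
      _ = _ := by rw [pow_succ]; ring
  have hdis : ∀ k l y, cutoff (x k) (δ k) y ≠ 0 → l ≠ k → cutoff (x l) (δ l) y = 0 := by
    intro k l y hk hlk
    apply hz
    have := hloc k y (hnz k y hk)
    have p1 : 0 < (1 / 2 : ℝ) ^ k := by positivity
    have p2 : 0 < (1 / 2 : ℝ) ^ l := by positivity
    rcases lt_or_gt_of_ne hlk with h | h
    · left; have := hpair _ _ h; linarith
    · right; have := hpair _ _ h; linarith
  have hsingle : ∀ k y, cutoff (x k) (δ k) y ≠ 0 → ∑' l, M l * cutoff (x l) (δ l) y = M k * cutoff (x k) (δ k) y := by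
    intro k y hk
    apply tsum_eq_single
    intro l hl
    rw [hdis k l y hk hl, mul_zero]
  refine ⟨fun y => 1 + ∑' l, M l * cutoff (x l) (δ l) y, ?_, ?_, ?_, ?_⟩
  · intro y hy
    apply ContinuousAt.continuousWithinAt
    have hy' : ‖y‖ < 1 := by simpa [unitBall] using hy
    obtain ⟨R, hR1, hR2⟩ := exists_between hy'
    obtain ⟨K, hK⟩ := exists_pow_lt_of_lt_one (y := (1/2:ℝ)) (sub_pos.2 hR2) (by norm_num)
    have hev : (fun y => 1 + ∑ l ∈ Finset.range K, M l * cutoff (x l) (δ l) y) =ᶠ[𝓝 y]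
        (fun y => 1 + ∑' l, M l * cutoff (x l) (δ l) y) := by
      have : ∀ᶠ z in 𝓝 y, ‖z‖ < R := continuous_norm.continuousAt.eventually (gt_mem_nhds hR1)
      filter_upwards [this] with z hzR
      rw [tsum_eq_sum]
      intro l hl
      rw [hz, mul_zero]
      right
      have h3 : K ≤ l := by simpa using hl
      have : (1/2:ℝ)^l ≤ (1/2)^K := pow_le_pow_of_le_one (by norm_num) (by norm_num) h3
      have p2 : 0 < (1 / 2 : ℝ) ^ l := by positivity
      linarith
    refine ContinuousAt.congr ?_ hev
    apply Continuous.continuousAt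
    exact continuous_const.add (continuous_finsetSum _ fun l _ => continuous_const.mul (hcont l))
  · intro y
    have : 0 ≤ ∑' l, M l * cutoff (x l) (δ l) y := tsum_nonneg fun l => mul_nonneg (hM l) (h0 l y)
    show 1 ≤ 1 + _
    linarith
  · intro k y hy
    have h2 := hone k y hy
    show M k ≤ 1 + ∑' l, M l * cutoff (x l) (δ l) y
    rw [hsingle k y (by rw [h2]; exact one_ne_zero), h2]
    linarith
  · intro y
    by_cases h : ∃ k, cutoff (x k) (δ k) y ≠ 0
    · obtain ⟨k, hk⟩ := h
      refine Or.inr ⟨k, hnz k y hk, ?_⟩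
      show 1 + ∑' l, M l * cutoff (x l) (δ l) y ≤ _
      rw [hsingle k y hk]
      nlinarith [hM k, h1 k y]
    · left
      push Not at h
      show 1 + ∑' l, M l * cutoff (x l) (δ l) y = 1
      simp [h]

lemma weight_Ls {N : ℕ} (x : ℕ → EuclideanSpace ℝ (Fin N)) (δ M : ℕ → ℝ)
    (w : EuclideanSpace ℝ (Fin N) → ℝ) {s : ℝ} (hs : 0 ≤ s) (hw1 : ∀ y, 1 ≤ w y)
    (hw : ∀ y, w y = 1 ∨ ∃ k, y ∈ Metric.ball (x k) (2 * δ k) ∧ w y ≤ 1 + M k)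
    (hev : ∀ᶠ k in atTop, ENNReal.ofReal ((1 + M k) ^ s) * volume (Metric.ball (x k) (2 * δ k)) ≤
      ENNReal.ofReal ((1 / 2) ^ k)) :
    ∫⁻ y in unitBall N, ENNReal.ofReal (w y) ^ s ≠ ⊤ := by
  set f : ℕ → ℝ≥0∞ := fun k => ENNReal.ofReal ((1 + M k) ^ s) * volume (Metric.ball (x k) (2 * δ k)) with hf
  have hffin : ∀ k, f k ≠ ⊤ := fun k => ENNReal.mul_ne_top ENNReal.ofReal_ne_top measure_ball_lt_top.ne
  obtain ⟨K, hK⟩ := eventually_atTop.1 hev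
  have hsum : ∑' k, f k ≠ ⊤ := by
    have hle : ∀ k, f k ≤ (if k ∈ Finset.range K then f k else 0) + ENNReal.ofReal ((1 / 2) ^ k) := by
      intro k
      by_cases h : k ∈ Finset.range K
      · simp [h]
      · rw [if_neg h, zero_add]
        exact hK k (by simpa using h)
    refine ne_top_of_le_ne_top ?_ (ENNReal.tsum_le_tsum hle)
    rw [ENNReal.tsum_add]
    refine ENNReal.add_ne_top.2 ⟨?_, ?_⟩
    · rw [tsum_eq_sum (s := Finset.range K) (fun k hk => if_neg hk)]
      refine (ENNReal.sum_lt_top.2 fun k hk => ?_).ne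
      rw [if_pos hk]
      exact (hffin k).lt_top
    · rw [← ENNReal.ofReal_tsum_of_nonneg (fun k => by positivity) (summable_geometric_of_lt_one (by norm_num) (by norm_num))]
      exact ENNReal.ofReal_ne_top
  have hpt : ∀ y, ENNReal.ofReal (w y) ^ s ≤
      1 + ∑' k, (Metric.ball (x k) (2 * δ k)).indicator (fun _ => ENNReal.ofReal ((1 + M k) ^ s)) y := by
    intro y
    rcases hw y with h | ⟨k, hk, h⟩
    · rw [h]; simp
    · refine le_trans ?_ le_add_self
      refine le_trans ?_ (ENNReal.le_tsum k)
      rw [indicator_of_mem hk, ENNReal.ofReal_rpow_of_nonneg (by linarith [hw1 y]) hs]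
      apply ENNReal.ofReal_le_ofReal
      have := hw1 y
      gcongr
  refine ne_top_of_le_ne_top ?_ (lintegral_mono hpt)
  rw [lintegral_add_left measurable_const, lintegral_tsum]
  swap
  · intro k
    exact (measurable_const.indicator measurableSet_ball).aemeasurable
  refine ENNReal.add_ne_top.2 ⟨?_, ?_⟩
  · simp only [lintegral_const, one_mul, Measure.restrict_apply_univ, unitBall]
    exact measure_ball_lt_top.ne
  · refine ne_top_of_le_ne_top hsum (ENNReal.tsum_le_tsum fun k => ?_)
    rw [lintegral_indicator_const measurableSet_ball]
    exact mul_le_mul_right (Measure.restrict_apply_le _ _) _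

lemma lower_one {N : ℕ} (hN : 2 ≤ N) {α γ δ d M t : ℝ} (hα : 0 < α) (hγ : α ≤ γ) (x₀ : EuclideanSpace ℝ (Fin N))
    (w u : EuclideanSpace ℝ (Fin N) → ℝ) (hwc : ContinuousOn w (unitBall N)) (hw1 : ∀ y, 1 ≤ w y)
    (hwM : ∀ y ∈ Metric.ball x₀ δ, M ≤ w y) (hM : 0 ≤ M) (ht : 0 ≤ t)
    (hδd : δ ≤ d) (hu : ContDiff ℝ ∞ u) (hus : tsupport u ⊆ Metric.closedBall x₀ d)
    (hball : Metric.closedBall x₀ d ⊆ unitBall N)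
    (hE : ∫⁻ x, ‖fderiv ℝ u x‖ₑ ^ (N:ℝ) ≤ 1) (hut : ∀ x ∈ Metric.ball x₀ δ, t ≤ u x) :
    IsTest (unitBall N) u ∧ (∫ x in unitBall N, ‖fderiv ℝ u x‖ ^ N) ≤ 1 ∧
      M * volume.real (Metric.ball x₀ δ) * PhiGamma N α t ≤ ∫ x in unitBall N, PhiGamma N γ (u x) * w x := by
  have hcs : HasCompactSupport u := (isCompact_closedBall x₀ d).of_isClosed_subset (isClosed_tsupport u) hus
  have htest : IsTest (unitBall N) u := ⟨hu, hcs, hus.trans hball⟩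
  have hγ0 : 0 ≤ γ := hα.le.trans hγ
  refine ⟨htest, ?_, ?_⟩
  · rw [← energy_conv hN htest] at hE
    exact ENNReal.ofReal_le_one.1 hE
  have hnn : ∀ x, 0 ≤ PhiGamma N γ (u x) * w x := fun x =>
    mul_nonneg (Phi_nonneg hγ0 _) (by linarith [hw1 x])
  have hzero : ∀ x, x ∉ Metric.closedBall x₀ d → PhiGamma N γ (u x) * w x = 0 := by
    intro x hx
    rw [image_eq_zero_of_notMem_tsupport (fun h => hx (hus h)), Phi_zero hN, zero_mul]
  have hco : ContinuousOn (fun x => PhiGamma N γ (u x) * w x) (Metric.closedBall x₀ d) :=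
    (((Phi_continuous hN γ).comp hu.continuous).continuousOn).mul (hwc.mono hball)
  have hInt : IntegrableOn (fun x => PhiGamma N γ (u x) * w x) (Metric.closedBall x₀ d) :=
    hco.integrableOn_compact (isCompact_closedBall x₀ d)
  have e1 : ∫ x in unitBall N, PhiGamma N γ (u x) * w x = ∫ x in Metric.closedBall x₀ d, PhiGamma N γ (u x) * w x :=
    (setIntegral_eq_of_subset_of_forall_sdiff_eq_zero Metric.isOpen_ball.measurableSet hball
      (fun x hx => hzero x hx.2))
  rw [e1]
  have hsub : Metric.ball x₀ δ ⊆ Metric.closedBall x₀ d :=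
    (Metric.ball_subset_ball hδd).trans Metric.ball_subset_closedBall
  calc M * volume.real (Metric.ball x₀ δ) * PhiGamma N α t
      = ∫ x in Metric.ball x₀ δ, PhiGamma N α t * M := by
        rw [setIntegral_const, smul_eq_mul]; ring
    _ ≤ ∫ x in Metric.ball x₀ δ, PhiGamma N γ (u x) * w x := by
        apply setIntegral_mono_on (integrableOn_const measure_ball_lt_top.ne) (hInt.mono_set hsub) measurableSet_ball
        intro x hx
        exact mul_le_mul (Phi_mono hN hα.le hγ ht (hut x hx)) (hwM x hx) hM (Phi_nonneg hγ0 _)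
    _ ≤ _ := setIntegral_mono_set hInt (Eventually.of_forall hnn) hsub.eventuallyLE

lemma main_aux (N : ℕ) (hN : 2 ≤ N)
    (α : ℝ) (hα0 : 0 < α) (hα : α < alphaMT N) :
    ∃ w : EuclideanSpace ℝ (Fin N) → ℝ, ContinuousOn w (unitBall N) ∧
      (∀ x, 1 ≤ w x) ∧
      ∀ γ : ℝ, 0 < γ →
        (BddAbove {s : ℝ | ∃ u : EuclideanSpace ℝ (Fin N) → ℝ, IsTest (unitBall N) u ∧
            (∫ x in unitBall N, ‖fderiv ℝ u x‖ ^ N) ≤ 1 ∧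
            s = ∫ x in unitBall N, PhiGamma N γ (u x) * w x} ↔ γ < α) := by
  have hA : 0 < alphaMT N := hα0.trans hα
  set a := α / alphaMT N with ha
  have ha0 : 0 < a := div_pos hα0 hA
  have ha1 : a < 1 := (div_lt_one hA).2 hα
  have h1a : 0 < 1 - a := by linarith
  set S := (1 - a)⁻¹ with hS
  have hS1 : 1 < S := (one_lt_inv₀ h1a).2 (by linarith)
  let sk : ℕ → ℝ := fun k => S - (S - 1) * (1 / ((k:ℝ) + 1))
  have hsk1 : ∀ k, 1 ≤ sk k := by
    intro k
    have : 1 / ((k:ℝ) + 1) ≤ 1 := by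
      rw [div_le_one (by positivity)]; linarith [(Nat.cast_nonneg k : (0:ℝ) ≤ k)]
    simp only [sk]
    nlinarith
  have hskS : ∀ k, sk k * (1 - a) < 1 := by
    intro k
    have : 0 < 1 / ((k:ℝ) + 1) := by positivity
    have h2 : sk k < S := by simp only [sk]; nlinarith
    calc sk k * (1 - a) < S * (1 - a) := by gcongr
      _ = 1 := inv_mul_cancel₀ h1a.ne'
  have hskt : Tendsto sk atTop (𝓝 S) := by
    have := (tendsto_one_div_add_atTop_nhds_zero_nat (𝕜 := ℝ)).const_mul (S - 1)
    simpa [sk] using this.const_sub S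
  let e : EuclideanSpace ℝ (Fin N) := EuclideanSpace.single ⟨0, by omega⟩ 1
  have he : ‖e‖ = 1 := by simp [e]
  let x : ℕ → EuclideanSpace ℝ (Fin N) := fun k => (1 - (1/2:ℝ)^k / 2) • e
  have hxn : ∀ k, ‖x k‖ = 1 - (1/2:ℝ)^k / 2 := by
    intro k
    have : (1/2:ℝ)^k ≤ 1 := pow_le_one₀ (by norm_num) (by norm_num)
    simp only [x]
    rw [norm_smul, he, mul_one, Real.norm_of_nonneg (by linarith)]
  have hb := fun k : ℕ => bump hN (α := α) (s := sk k) (d := (1/2:ℝ)^k / 8) (ε := (1/2:ℝ)^k) (K := (k:ℝ))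
    hα0 (hsk1 k) (hskS k) (by positivity) (by positivity) (x k)
  choose δ M t u hδ h2δ hM ht hu hus hE hut hK hvol using hb
  have hgeom : ∀ k y, dist y (x k) ≤ (1/2:ℝ)^k / 8 → |‖y‖ - (1 - (1/2:ℝ)^k / 2)| ≤ (1/2:ℝ)^k / 8 := by
    intro k y h
    rw [← hxn k]
    refine (abs_norm_sub_norm_le _ _).trans ?_
    rwa [← dist_eq_norm]
  obtain ⟨w, hwc, hw1, hwM, hwd⟩ := weight_exists x δ M hδ hM (by
    intro k y hy
    have h2 : dist y (x k) < (1/2:ℝ)^k / 8 := lt_of_lt_of_le hy (h2δ k)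
    have h3 : |‖y‖ - ‖x k‖| < (1/2:ℝ)^k / 8 := by
      refine (abs_norm_sub_norm_le _ _).trans_lt ?_
      rwa [← dist_eq_norm]
    rw [hxn, abs_lt] at h3
    constructor <;> linarith [h3.1, h3.2])
  refine ⟨w, hwc, hw1, fun γ hγ => ⟨?_, ?_⟩⟩
  · rintro ⟨C, hC⟩
    by_contra! hcon
    obtain ⟨k, hk⟩ := exists_nat_gt C
    have hdk : 0 < (1/2:ℝ)^k := by positivity
    obtain ⟨h1, h2, h3⟩ := lower_one hN hα0 hcon (x k) w (u k) hwc hw1 (hwM k) (hM k) (ht k)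
      (by linarith [h2δ k, hδ k]) (hu k) (hus k) (by
        intro y hy
        have := hgeom k y hy
        rw [abs_le] at this
        rw [unitBall, mem_ball_zero_iff]
        linarith [this.2]) (hE k) (hut k)
    have h4 := hC ⟨u k, h1, h2, rfl⟩
    linarith [hK k]
  · intro hlt
    obtain ⟨γ', hg1, hg2⟩ := exists_between hlt
    have hg0 : 0 < γ' := hγ.trans hg1
    have hp1 : 1 < alphaMT N / γ' := by rw [lt_div_iff₀ hg0]; linarith
    have hc := Real.HolderConjugate.conjExponent hp1
    refine upper hN hγ hc ?_ w (fun y _ => by linarith [hw1 y]) hwc ?_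
    · rw [div_mul_eq_mul_div, div_lt_iff₀ hg0]
      gcongr
    · have hs0 := hc.symm.pos
      refine weight_Ls x δ M w hs0.le hw1 hwd ?_
      have hsS : Real.conjExponent (alphaMT N / γ') < S := by
        have h5 : Real.conjExponent (alphaMT N / γ') = (1 - γ' / alphaMT N)⁻¹ := by
          rw [Real.conjExponent]
          have : alphaMT N - γ' ≠ 0 := by linarith
          field_simp
        rw [h5, hS]
        apply inv_strictAnti₀ h1a
        have : γ' / alphaMT N < a := by rw [ha]; gcongr
        linarith
      filter_upwards [hskt.eventually (lt_mem_nhds hsS)] with k hk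
      refine le_trans ?_ (hvol k)
      gcongr
      · linarith [hM k]
end

/-- For `N ≥ 2` and `α ∈ (0, α_N)` there is a conformal metric `g_ρ = ρ g_e` on the unit ball
such that, for `γ > 0`, the supremum of `∫_B Φ^γ(u) dV_{g_ρ}` over test functions with
Dirichlet energy at most `1` is finite if and only if `0 < γ < α`. -/
theorem exists_metric_exponential_summability_below_alpha (N : ℕ) (hN : 2 ≤ N)
    (α : ℝ) (hα0 : 0 < α) (hα : α < alphaMT N) :
    ∃ ρ : EuclideanSpace ℝ (Fin N) → ℝ, ContinuousOn ρ (unitBall N) ∧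
      (∀ x ∈ unitBall N, 0 < ρ x) ∧
      ∀ γ : ℝ, 0 < γ →
        (BddAbove {s : ℝ | ∃ u : EuclideanSpace ℝ (Fin N) → ℝ, IsTest (unitBall N) u ∧
            (∫ x in unitBall N, ‖fderiv ℝ u x‖ ^ N) ≤ 1 ∧
            s = ∫ x in unitBall N, PhiGamma N γ (u x) * ρ x ^ ((N : ℝ) / 2)} ↔
          (0 < γ ∧ γ < α)) := by
  obtain ⟨w, hwc, hw1, hw⟩ := main_aux N hN α hα0 hα
  have hN0 : (N : ℝ) ≠ 0 := by
    have : 0 < N := by omega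
    positivity
  have hpos : ∀ x, 0 < w x := fun x => lt_of_lt_of_le one_pos (hw1 x)
  have hpow : ∀ x, (w x ^ (2 / (N : ℝ))) ^ ((N : ℝ) / 2) = w x := by
    intro x
    rw [← Real.rpow_mul (hpos x).le]
    have : 2 / (N : ℝ) * ((N : ℝ) / 2) = 1 := by field_simp
    rw [this, Real.rpow_one]
  refine ⟨fun x => w x ^ (2 / (N : ℝ)), ?_, ?_, ?_⟩
  · exact hwc.rpow_const (fun x _ => Or.inl (hpos x).ne')
  · intro x _
    exact Real.rpow_pos_of_pos (hpos x) _
  · intro γ hγ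
    simp only [hpow]
    rw [hw γ hγ]
    exact ⟨fun h => ⟨hγ, h⟩, fun h => h.2⟩
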